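/- In the algebra Uı, for all integers a ≥ 0, l ≥ 0 and every integer d, the following identity holds: B₁ · (B₂^{(a)} B₁^{(l+a+d)} B₂^{(l)}) = [l+1+d] · B₂^{(a)} B₁^{(l+a+d+1)} B₂^{(l)} + [l+1] · B₂^{(a−1)} B₁^{(l+a+d+1)} B₂^{(l+1)} − [l+1+d] · B₂^{(a−1)} B₁^{(l+a+d)} B₂^{(l)} · {k₁; l − a − 1/2 − 2d}, where divided powers with negative superscript are zero. -/

import Mathlib

noncomputable section

namespace UiAIII

/-- The base field `K = ℚ(t)`, where `q := t²`. -/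
abbrev K : Type := RatFunc ℚ

/-- `t^s` for `s : ℤ`; so `tz (2*n)` represents `q^n` and `tz s` represents `q^{s/2}`. -/
def tz (s : ℤ) : K := (RatFunc.X : K) ^ s

/-- The quantum integer `[n] = (q^n - q^{-n})/(q - q^{-1})`, with `q = t²`. -/
def qint (n : ℤ) : K := (tz (2 * n) - tz (-(2 * n))) / (tz 2 - tz (-2))

/-- The quantum factorial `[n]!`. -/
def qfact (n : ℕ) : K := ∏ i ∈ Finset.range n, qint ((i : ℤ) + 1)

variable {A : Type*} [Ring A] [Algebra K A]

/-- Divided power `x^{(m)} = x^m/[m]!` for `m ≥ 0`, and `0` for `m < 0`. -/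
def dp (x : A) (m : ℤ) : A := if 0 ≤ m then (qfact m.toNat)⁻¹ • x ^ m.toNat else 0

/-- `{k; s/2} := q^{s/2}·k + q^{-s/2}·k⁻¹`; the argument `s` is twice the half-integer. -/
def brace (k kinv : A) (s : ℤ) : A := tz s • k + tz (-s) • kinv

/-- `k^j` for `j : ℤ`, using the two-sided inverse `kinv` of `k`. -/
def upow (k kinv : A) (j : ℤ) : A := if 0 ≤ j then k ^ j.toNat else kinv ^ (-j).toNat

end UiAIII

open UiAIII

namespace UiAIII

/-- Preferred over the instance coming from `ℚ[X]`, with which the `module` tactic fails. -/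
instance : Algebra ℕ K := Semiring.toNatAlgebra

/-- Preferred over the instance coming from `ℚ[X]`, with which the `module` tactic fails. -/
instance : Algebra ℤ K := Ring.toIntAlgebra K

theorem tz_add (m n : ℤ) : tz (m + n) = tz m * tz n := zpow_add₀ RatFunc.X_ne_zero m n

theorem tz_sub (m n : ℤ) : tz (m - n) = tz m * (tz n)⁻¹ :=
  (zpow_sub₀ RatFunc.X_ne_zero m n).trans (div_eq_mul_inv _ _)

theorem tz_neg (m : ℤ) : tz (-m) = (tz m)⁻¹ := zpow_neg _ m

theorem tz_ne_zero (m : ℤ) : tz m ≠ 0 := zpow_ne_zero m RatFunc.X_ne_zero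

theorem tz_zero : tz 0 = 1 := zpow_zero _

theorem tz_natCast_ne_one {n : ℕ} (hn : n ≠ 0) : tz n ≠ 1 := by
  intro h
  have hX : (RatFunc.X : RatFunc ℚ) ^ n = 1 := by simpa [tz] using h
  rw [← RatFunc.algebraMap_X, ← map_pow, ← map_one (algebraMap (Polynomial ℚ) (RatFunc ℚ))] at hX
  have := congrArg Polynomial.natDegree (RatFunc.algebraMap_injective ℚ hX)
  simp [hn] at this

theorem tz_sub_tz_neg_ne_zero {n : ℕ} (hn : n ≠ 0) : tz n - tz (-n) ≠ 0 := by
  intro h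
  have h1 : tz ((n + n : ℕ) : ℤ) = 1 := by
    rw [Nat.cast_add, tz_add]
    nth_rewrite 1 [sub_eq_zero.1 h]
    rw [tz_neg, inv_mul_cancel₀ (tz_ne_zero _)]
  exact tz_natCast_ne_one (by omega) h1

theorem qint_denom_ne_zero : tz 2 - tz (-2) ≠ 0 := tz_sub_tz_neg_ne_zero two_ne_zero

theorem qint_zero : qint 0 = 0 := by simp [qint]

theorem qint_neg (n : ℤ) : qint (-n) = -qint n := by
  simp only [qint, mul_neg, neg_neg]
  ring

theorem qint_one : qint 1 = 1 := by
  simpa [qint] using div_self qint_denom_ne_zero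

theorem qint_natCast_succ_ne_zero (n : ℕ) : qint ((n : ℤ) + 1) ≠ 0 := by
  refine div_ne_zero ?_ qint_denom_ne_zero
  have := tz_sub_tz_neg_ne_zero (n := 2 * (n + 1)) (by omega)
  push_cast at this
  exact this

theorem qint_mul_tz (n s : ℤ) :
    qint n * tz s = (tz (2 * n + s) - tz (s - 2 * n)) / (tz 2 - tz (-2)) := by
  rw [qint, div_mul_eq_mul_div, sub_mul, ← tz_add, ← tz_add, neg_add_eq_sub]

theorem qint_mul_two_sub (n : ℤ) : qint (n + 1) * qint 2 - qint n = qint (n + 2) := by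
  have hd := qint_denom_ne_zero
  simp only [qint]
  field_simp
  simp only [mul_add, mul_sub, neg_add, mul_one, tz_add, tz_neg, two_mul]
  field_simp [tz_ne_zero]
  ring

theorem qint_mul_sub_mul (n a : ℤ) :
    qint n * qint a - qint (a - 1) * qint (n + 1) = qint (n + 1 - a) := by
  have hd := qint_denom_ne_zero
  simp only [qint]
  field_simp
  simp only [mul_add, mul_sub, neg_add, neg_sub, mul_one, tz_add, tz_sub, tz_neg, two_mul]
  field_simp [tz_ne_zero]
  ring

theorem qfact_succ (n : ℕ) : qfact (n + 1) = qfact n * qint ((n : ℤ) + 1) :=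
  Finset.prod_range_succ _ _

section Algebra

variable {A : Type*} [Ring A] [Algebra K A]

theorem dp_natCast (x : A) (n : ℕ) : dp x n = (qfact n)⁻¹ • x ^ n := by simp [dp]

theorem dp_natCast_succ (x : A) (n : ℕ) :
    dp x ((n : ℤ) + 1) = ((qfact n)⁻¹ * (qint ((n : ℤ) + 1))⁻¹) • x ^ (n + 1) := by
  rw [← Nat.cast_add_one, dp_natCast, qfact_succ, mul_inv, Nat.cast_add_one]

theorem dp_of_neg (x : A) {n : ℤ} (hn : n < 0) : dp x n = 0 := if_neg (not_le.2 hn)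

theorem dp_zero (x : A) : dp x 0 = 1 := by simp [dp, qfact]

theorem mul_dp (x : A) (n : ℤ) : x * dp x n = qint (n + 1) • dp x (n + 1) := by
  rcases lt_trichotomy n (-1) with h | rfl | h
  · rw [dp_of_neg x (by omega), dp_of_neg x (by omega), mul_zero, smul_zero]
  · simp [dp_of_neg, qint_zero]
  · lift n to ℕ using by omega
    rw [dp_natCast, dp_natCast_succ, mul_smul_comm, ← pow_succ', smul_smul]
    congr 1
    field_simp [qint_natCast_succ_ne_zero n]

theorem commute_dp (x : A) (n : ℤ) : Commute x (dp x n) := by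
  unfold dp
  split_ifs
  · exact ((Commute.refl x).pow_right _).smul_right _
  · exact Commute.zero_right x

theorem mul_pow_of_mul_eq_smul {k x : A} {c : ℤ} (h : k * x = tz c • (x * k)) (n : ℕ) :
    k * x ^ n = tz (c * n) • (x ^ n * k) := by
  induction n with
  | zero => simp [tz_zero]
  | succ n ih =>
    rw [pow_succ, ← mul_assoc, ih, smul_mul_assoc, mul_assoc, h, mul_smul_comm, smul_smul,
      ← tz_add, mul_assoc]
    congr 2
    push_cast
    ring

theorem inv_mul_eq_smul {k k' x : A} {c : ℤ} (hk : k * k' = 1) (hk' : k' * k = 1)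
    (h : k * x = tz c • (x * k)) : k' * x = tz (-c) • (x * k') := by
  have h1 : x * k' = tz c • (k' * x) := by
    calc x * k' = k' * (k * x) * k' := by rw [← mul_assoc, hk', one_mul]
      _ = tz c • (k' * x) := by
        rw [h, mul_smul_comm, smul_mul_assoc, ← mul_assoc, mul_assoc, hk, mul_one]
  rw [h1, smul_smul, ← tz_add, neg_add_cancel, tz_zero, one_smul]

theorem brace_mul_pow {k k' x : A} {c : ℤ} (hk : k * k' = 1) (hk' : k' * k = 1)
    (h : k * x = tz c • (x * k)) (s : ℤ) (n : ℕ) :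
    brace k k' s * x ^ n = x ^ n * brace k k' (s + c * n) := by
  simp only [brace, add_mul, mul_add, smul_mul_assoc, mul_smul_comm,
    mul_pow_of_mul_eq_smul h n, mul_pow_of_mul_eq_smul (inv_mul_eq_smul hk hk' h) n, smul_smul,
    ← tz_add]
  congr 3
  ring

theorem brace_mul_dp {k k' x : A} {c : ℤ} (hk : k * k' = 1) (hk' : k' * k = 1)
    (h : k * x = tz c • (x * k)) (s n : ℤ) :
    brace k k' s * dp x n = dp x n * brace k k' (s + c * n) := by
  rcases lt_or_ge n 0 with hn | hn
  · simp [dp_of_neg x hn]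
  · lift n to ℕ using hn
    rw [dp_natCast, mul_smul_comm, smul_mul_assoc, brace_mul_pow hk hk' h]

theorem qint_smul_brace_step_left (k k' : A) (n : ℤ) :
    qint 2 • brace k k' (-3 - 6 * n) + qint n • brace k k' (1 - 4 * n) =
      qint (n + 2) • brace k k' (-3 - 4 * n) := by
  simp only [brace]
  match_scalars <;> simp only [mul_one, qint_mul_tz] <;> ring_nf

theorem qint_smul_brace_step_right (k k' : A) (n : ℤ) :
    qint 2 • brace k k' 3 + qint n • brace k k' (2 * n + 1 + 6) =
      qint (n + 2) • brace k k' (2 * n + 3) := by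
  simp only [brace]
  match_scalars <;> simp only [mul_one, qint_mul_tz] <;> ring_nf

theorem qint_smul_brace_sub (k k' : A) (n a : ℤ) :
    qint (a - 1) • brace k k' (2 * a - 1 - 6 * n) - qint n • brace k k' (1 - 4 * n) =
      -(qint (n + 1 - a) • brace k k' (2 * a - 1 - 4 * n)) := by
  simp only [brace]
  match_scalars <;> simp only [mul_one, qint_mul_tz] <;> ring_nf

/-- Moving `y` to the right past `x ^ n`, where `x, y` satisfy the first iSerre relation. -/
theorem pow_succ_mul_of_serre {x y k k' : A} (hk : k * k' = 1) (hk' : k' * k = 1)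
    (hkx : k * x = tz (-6) • (x * k))
    (hS : x ^ 2 * y - qint 2 • (x * y * x) + y * x ^ 2 = qint 2 • (x * brace k k' (-3))) (n : ℕ) :
    x ^ (n + 1) * y = qint (n + 1) • (x * y * x ^ n) - qint n • (y * x ^ (n + 1)) +
      (qint n * qint (n + 1)) • (x ^ n * brace k k' (1 - 4 * n)) := by
  induction n with
  | zero => simp [qint_zero, qint_one]
  | succ n ih =>
    have h2 : x ^ 2 * y = qint 2 • (x * y * x) - y * x ^ 2 + qint 2 • (x * brace k k' (-3)) := by
      rw [← hS]
      abel
    calc x ^ (n + 1 + 1) * y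
        = qint (n + 1) • (x ^ 2 * y * x ^ n) - qint n • (x * y * x ^ (n + 1)) +
          (qint n * qint (n + 1)) • (x ^ (n + 1) * brace k k' (1 - 4 * n)) := by
          rw [pow_succ' x (n + 1), mul_assoc, ih]
          simp only [mul_add, mul_sub, mul_smul_comm, mul_assoc, pow_succ', pow_zero, one_mul]
      _ = (qint (n + 1) * qint 2 - qint n) • (x * y * x ^ (n + 1)) -
          qint (n + 1) • (y * x ^ (n + 1 + 1)) + qint (n + 1) • (x ^ (n + 1) *
            (qint 2 • brace k k' (-3 - 6 * n) + qint n • brace k k' (1 - 4 * n))) := by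
          rw [h2]
          simp only [add_mul, sub_mul, mul_add, mul_smul_comm, smul_mul_assoc, mul_assoc,
            brace_mul_pow hk hk' hkx, pow_succ', pow_zero, mul_one]
          rw [show (-3 : ℤ) + -6 * n = -3 - 6 * n by ring]
          module
      _ = _ := by
          rw [qint_mul_two_sub, qint_smul_brace_step_left]
          push_cast
          rw [show (n : ℤ) + 1 + 1 = n + 2 by ring,
            show 1 - 4 * ((n : ℤ) + 1) = -3 - 4 * n by ring, mul_smul_comm, smul_smul]

/-- Moving `y` to the left past `x ^ n`, where `x, y` satisfy the second iSerre relation. -/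
theorem mul_pow_succ_of_serre {x y k k' : A} (hk : k * k' = 1) (hk' : k' * k = 1)
    (hkx : k * x = tz 6 • (x * k))
    (hS : x ^ 2 * y - qint 2 • (x * y * x) + y * x ^ 2 = qint 2 • (x * brace k k' 3)) (n : ℕ) :
    y * x ^ (n + 1) = qint (n + 1) • (x ^ n * y * x) - qint n • (x ^ (n + 1) * y) +
      (qint n * qint (n + 1)) • (x ^ n * brace k k' (2 * n + 1)) := by
  induction n with
  | zero => simp [qint_zero, qint_one]
  | succ n ih =>
    have h2 : y * x ^ 2 = qint 2 • (x * y * x) - x ^ 2 * y + qint 2 • (x * brace k k' 3) := by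
      rw [← hS]
      abel
    have hb : brace k k' (2 * n + 1) * x = x * brace k k' (2 * n + 1 + 6) := by
      simpa using brace_mul_pow hk hk' hkx (2 * n + 1) 1
    calc y * x ^ (n + 1 + 1)
        = qint (n + 1) • (x ^ n * (y * x ^ 2)) - qint n • (x ^ (n + 1) * y * x) +
          (qint n * qint (n + 1)) • (x ^ (n + 1) * brace k k' (2 * n + 1 + 6)) := by
          rw [pow_succ x (n + 1), ← mul_assoc, ih]
          simp only [add_mul, sub_mul, smul_mul_assoc, pow_two, mul_assoc, hb]
          simp only [pow_succ, mul_assoc]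
      _ = (qint (n + 1) * qint 2 - qint n) • (x ^ (n + 1) * y * x) -
          qint (n + 1) • (x ^ (n + 1 + 1) * y) + qint (n + 1) • (x ^ (n + 1) *
            (qint 2 • brace k k' 3 + qint n • brace k k' (2 * n + 1 + 6))) := by
          rw [h2]
          simp only [mul_add, mul_sub, mul_smul_comm, mul_assoc, pow_succ, pow_zero, one_mul]
          module
      _ = _ := by
          rw [qint_mul_two_sub, qint_smul_brace_step_right]
          push_cast
          rw [show (n : ℤ) + 1 + 1 = n + 2 by ring,
            show 2 * ((n : ℤ) + 1) + 1 = 2 * n + 3 by ring, mul_smul_comm, smul_smul]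

theorem mul_mul_dp {x y k k' : A} (hk : k * k' = 1) (hk' : k' * k = 1)
    (hkx : k * x = tz (-6) • (x * k))
    (hS : x ^ 2 * y - qint 2 • (x * y * x) + y * x ^ 2 = qint 2 • (x * brace k k' (-3))) (n : ℤ) :
    x * y * dp x n = qint n • (y * dp x (n + 1)) + dp x (n + 1) * y -
      qint n • (dp x n * brace k k' (1 - 4 * n)) := by
  rcases lt_trichotomy n (-1) with h | rfl | h
  · simp [dp_of_neg x (show n < 0 by omega), dp_of_neg x (show n + 1 < 0 by omega)]
  · simp [dp_of_neg, dp_zero, qint_neg, qint_one]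
  · lift n to ℕ using by omega
    have h0 := qint_natCast_succ_ne_zero n
    rw [dp_natCast_succ, dp_natCast, smul_mul_assoc, pow_succ_mul_of_serre hk hk' hkx hS]
    simp only [mul_smul_comm, smul_mul_assoc]
    match_scalars <;> field_simp <;> ring

theorem dp_mul_mul {x y k k' : A} (hk : k * k' = 1) (hk' : k' * k = 1)
    (hkx : k * x = tz 6 • (x * k))
    (hS : x ^ 2 * y - qint 2 • (x * y * x) + y * x ^ 2 = qint 2 • (x * brace k k' 3)) (n : ℤ) :
    y * dp x (n + 1) = dp x n * y * x - qint n • (dp x (n + 1) * y) +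
      qint n • (dp x n * brace k k' (2 * n + 1)) := by
  rcases lt_trichotomy n (-1) with h | rfl | h
  · simp [dp_of_neg x (show n < 0 by omega), dp_of_neg x (show n + 1 < 0 by omega)]
  · simp [dp_of_neg, dp_zero, qint_neg, qint_one]
  · lift n to ℕ using by omega
    have h0 := qint_natCast_succ_ne_zero n
    rw [dp_natCast_succ, dp_natCast, mul_smul_comm, mul_pow_succ_of_serre hk hk' hkx hS]
    simp only [smul_mul_assoc]
    match_scalars <;> field_simp

/-- The straightening rule for `B₁ B₂^{(a)} B₁^{(n)}`. -/
theorem mul_dp_mul_dp {B1 B2 k k' : A} (hk : k * k' = 1) (hk' : k' * k = 1)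
    (hkB1 : k * B1 = tz (-6) • (B1 * k)) (hkB2 : k * B2 = tz 6 • (B2 * k))
    (hS1 : B1 ^ 2 * B2 - qint 2 • (B1 * B2 * B1) + B2 * B1 ^ 2 =
      qint 2 • (B1 * brace k k' (-3)))
    (hS2 : B2 ^ 2 * B1 - qint 2 • (B2 * B1 * B2) + B1 * B2 ^ 2 =
      qint 2 • (B2 * brace k k' 3)) (a n : ℤ) :
    B1 * (dp B2 a * dp B1 n) = qint (n + 1 - a) • (dp B2 a * dp B1 (n + 1)) +
      dp B2 (a - 1) * dp B1 (n + 1) * B2 -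
      qint (n + 1 - a) • (dp B2 (a - 1) * dp B1 n * brace k k' (2 * a - 1 - 4 * n)) := by
  have h2 := dp_mul_mul hk hk' hkB2 hS2 (a - 1)
  rw [sub_add_cancel, show 2 * (a - 1) + 1 = 2 * a - 1 by ring] at h2
  have hd : dp B2 (a - 1) * B2 = qint a • dp B2 a := by
    rw [← (commute_dp B2 (a - 1)).eq, mul_dp, sub_add_cancel]
  have hb := brace_mul_dp hk hk' hkB1 (2 * a - 1) n
  rw [show 2 * a - 1 + -6 * n = 2 * a - 1 - 6 * n by ring] at hb
  calc B1 * (dp B2 a * dp B1 n)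
      = dp B2 (a - 1) * (B1 * B2 * dp B1 n) - qint (a - 1) • (dp B2 a * (B1 * dp B1 n)) +
        qint (a - 1) • (dp B2 (a - 1) * (brace k k' (2 * a - 1) * dp B1 n)) := by
        rw [← mul_assoc, h2]
        simp only [add_mul, sub_mul, smul_mul_assoc, mul_assoc]
    _ = (qint n * qint a - qint (a - 1) * qint (n + 1)) • (dp B2 a * dp B1 (n + 1)) +
        dp B2 (a - 1) * dp B1 (n + 1) * B2 + dp B2 (a - 1) * dp B1 n *
          (qint (a - 1) • brace k k' (2 * a - 1 - 6 * n) - qint n • brace k k' (1 - 4 * n)) := by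
        rw [mul_mul_dp hk hk' hkB1 hS1, mul_dp, hb]
        simp only [mul_add, mul_sub, mul_smul_comm, ← mul_assoc, hd, smul_mul_assoc]
        module
    _ = _ := by
        rw [qint_mul_sub_mul, qint_smul_brace_sub, mul_neg, mul_smul_comm, ← sub_eq_add_neg]

end Algebra

end UiAIII

/-- Proposition (eq. 4.6) of the paper: for `a, l ≥ 0` and `d ∈ ℤ`,
`B₁·(B₂^{(a)} B₁^{(l+a+d)} B₂^{(l)}) = [l+1+d]·B₂^{(a)}B₁^{(l+a+d+1)}B₂^{(l)}
   + [l+1]·B₂^{(a−1)}B₁^{(l+a+d+1)}B₂^{(l+1)}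
   − [l+1+d]·B₂^{(a−1)}B₁^{(l+a+d)}B₂^{(l)}·{k₁; l−a−1/2−2d}`,
in any algebra with elements satisfying the defining relations of the quasi-split iquantum
group Uı of type AIII for sl₃ with parameters ς₁ = ς₂ = −q^{1/2}. -/
theorem statement1 (A : Type*) [Ring A] [Algebra K A]
    (B1 B2 k1 k1' : A)
    (hk : k1 * k1' = 1) (hk' : k1' * k1 = 1)
    (hkB1 : k1 * B1 = tz (-6) • (B1 * k1))
    (hkB2 : k1 * B2 = tz 6 • (B2 * k1))
    (hS1 : B1 ^ 2 * B2 - qint 2 • (B1 * B2 * B1) + B2 * B1 ^ 2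
        = qint 2 • (B1 * (tz (-3) • k1 + tz 3 • k1')))
    (hS2 : B2 ^ 2 * B1 - qint 2 • (B2 * B1 * B2) + B1 * B2 ^ 2
        = qint 2 • (B2 * (tz 3 • k1 + tz (-3) • k1')))
    (a l : ℕ) (d : ℤ) :
    B1 * (dp B2 (a : ℤ) * dp B1 ((l : ℤ) + a + d) * dp B2 (l : ℤ))
      = qint ((l : ℤ) + 1 + d) • (dp B2 (a : ℤ) * dp B1 ((l : ℤ) + a + d + 1) * dp B2 (l : ℤ))
        + qint ((l : ℤ) + 1) •
            (dp B2 ((a : ℤ) - 1) * dp B1 ((l : ℤ) + a + d + 1) * dp B2 ((l : ℤ) + 1))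
        - qint ((l : ℤ) + 1 + d) •
            (dp B2 ((a : ℤ) - 1) * dp B1 ((l : ℤ) + a + d) * dp B2 (l : ℤ) *
              brace k1 k1' (2 * (l : ℤ) - 2 * (a : ℤ) - 1 - 4 * d)) := by
  have hl : qint ((l : ℤ) + 1) • dp B2 ((l : ℤ) + 1) = B2 * dp B2 l := (mul_dp B2 l).symm
  have hb := brace_mul_dp hk hk' hkB2 (2 * a - 1 - 4 * ((l : ℤ) + a + d)) l
  rw [show 2 * (a : ℤ) - 1 - 4 * (l + a + d) + 6 * l = 2 * l - 2 * a - 1 - 4 * d by ring] at hb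
  rw [← mul_assoc, mul_dp_mul_dp hk hk' hkB1 hkB2 hS1 hS2,
    show (l : ℤ) + a + d + 1 - a = l + 1 + d by ring, sub_mul, add_mul]
  simp only [smul_mul_assoc, mul_assoc, hb, ← hl, mul_smul_comm]
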